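/- Let f ∈ Mould(m), g ∈ Mould(n) and 2 ≤ i ≤ m. Then τ(f ∘_i g) = τ(f) ∘_{i−1} g in Mould(m+n−1). -/

import Mathlib

/-!
Formalization of results from "The anticyclic operad of moulds" (F. Chapoton).

`Mould n` is the field of rational functions in variables `u 1, …, u n` with
rational coefficients, realized as a subfield of the fraction field `K` of
`ℚ[X 0, X 1, X 2, …]`.  The variable `u 0 = X 0` is reserved as an auxiliary
variable (the parameter `t` or `λ`).  Substitution of rational functions for
the variables is realized by the (partial, well-defined) function `msub`.
-/

noncomputable section
namespace MouldOperad

open MvPolynomial Finset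

attribute [local instance] Classical.propDecidable
set_option synthInstance.maxHeartbeats 1000000

abbrev MPoly : Type := MvPolynomial ℕ ℚ
abbrev K : Type := FractionRing MPoly

/-- the variable `u i` (1-based; index `0` is auxiliary). -/
def u (i : ℕ) : K := algebraMap MPoly K (X i)

/-- `u_{i..j} = u_i + u_{i+1} + ⋯ + u_j`. -/
def usum (i j : ℕ) : K := ∑ k ∈ Finset.Icc i j, u k

/-- evaluation of polynomials, sending the variable `X k` to `v k`. -/
def pev (v : ℕ → K) : MPoly →+* K :=
  eval₂Hom ((algebraMap MPoly K).comp (C : ℚ →+* MPoly)) v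

/-- Substitution of the rational functions `v k` for the variables of `f ∈ K`
(the induced field homomorphism): it takes the canonical value whenever `f` has
a fraction representation whose denominator does not vanish under the
substitution (this value does not depend on the representation), and the junk
value `0` otherwise. -/
def msub (v : ℕ → K) (f : K) : K :=
  if h : ∃ w : K, ∃ p q : MPoly, q ≠ 0 ∧
      f = algebraMap MPoly K p / algebraMap MPoly K q ∧
      pev v q ≠ 0 ∧ w = pev v p / pev v q
  then h.choose else 0

/-- the field `Mould n` of rational functions in `u 1, …, u n`. -/
def Mould (n : ℕ) : Subfield K :=
  Subfield.closure {x : K | ∃ i, 1 ≤ i ∧ i ≤ n ∧ x = u i}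

/-- substitution used for `f` in `f ∘_i g`, where `g` has degree `n`:
`f(u_1, …, u_{i-1}, u_{i..i+n-1}, u_{i+n}, …, u_{m+n-1})`. -/
def compSubF (n i : ℕ) : ℕ → K := fun k =>
  if k < i then u k else if k = i then usum i (i + n - 1) else u (k + n - 1)

/-- substitution used for `g` in `f ∘_i g` : `g(u_i, …, u_{i+n-1})`. -/
def compSubG (i : ℕ) : ℕ → K := fun k => u (k + i - 1)

/-- the composition `f ∘_i g`, where `g` has degree `n` (1-based index `i`). -/
def comp (n i : ℕ) (f g : K) : K :=
  usum i (i + n - 1) * msub (compSubF n i) f * msub (compSubG i) g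

/-- the push `τ` on `Mould n`: `τ(f)(u_1,…,u_n) = f(-u_{1..n}, u_1, …, u_{n-1})`. -/
def push (n : ℕ) (f : K) : K :=
  msub (fun k => if k = 1 then -(usum 1 n) else if k ≤ n then u (k - 1) else u k) f

/-- a permutation of `Fin n` as a (1-based) permutation of `ℕ`. -/
def permExt (n : ℕ) (σ : Equiv.Perm (Fin n)) : ℕ → ℕ := fun k =>
  if h : 1 ≤ k ∧ k ≤ n then ((σ ⟨k - 1, by omega⟩ : Fin n) : ℕ) + 1 else k

/-- `f ∈ Mould n` is alternal : for each `1 ≤ i ≤ n-1`, the sum of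
`f(u_{σ(1)}, …, u_{σ(n)})` over the shuffles `σ ∈ Sh(i, n-i)` vanishes. -/
def IsAlternal (n : ℕ) (f : K) : Prop :=
  ∀ i : ℕ, 1 ≤ i → i ≤ n - 1 →
    ∑ σ ∈ Finset.univ.filter (fun σ : Equiv.Perm (Fin n) =>
        (∀ a b : Fin n, a < b → (b : ℕ) < i → σ a < σ b) ∧
        (∀ a b : Fin n, a < b → i ≤ (a : ℕ) → σ a < σ b)),
      msub (fun k => u (permExt n σ k)) f = 0

/-- `f ∈ Mould n` is vegetal :
`u_1⋯u_n · Σ_{σ ∈ S_n} f(t·u_{σ(1)}, …, t·u_{σ(n)}) = n! · f(t,…,t)`,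
where the auxiliary variable `t` is `u 0`. -/
def IsVegetal (n : ℕ) (f : K) : Prop :=
  (∏ k ∈ Finset.Icc 1 n, u k) *
      ∑ σ : Equiv.Perm (Fin n), msub (fun k => u 0 * u (permExt n σ k)) f =
    (n.factorial : K) * msub (fun _ => u 0) f

/-- `f ∈ Mould n` is homogeneous of weight `d` : `f(λu_1,…,λu_n) = λ^d·f`,
where the auxiliary variable `λ` is `u 0`. -/
def IsHomogeneousOfWeight (n : ℕ) (d : ℤ) (f : K) : Prop :=
  msub (fun k => if 1 ≤ k ∧ k ≤ n then u 0 * u k else u k) f = u 0 ^ d * f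

/-- shift substitution : `g(u_{m+1}, …, u_{m+n})`. -/
def shiftSub (m : ℕ) : ℕ → K := fun k => u (k + m)

/-- `f ≻ g` for `f ∈ Mould m`, `g ∈ Mould n`. -/
def dsucc (m n : ℕ) (f g : K) : K :=
  f * msub (shiftSub m) g * usum (m + 1) (m + n) / usum 1 (m + n)

/-- `f ≺ g` for `f ∈ Mould m`, `g ∈ Mould n`. -/
def dprec (m n : ℕ) (f g : K) : K :=
  f * msub (shiftSub m) g * usum 1 m / usum 1 (m + n)

/-- `MU(f,g)` for `f ∈ Mould m`. -/
def MU (m : ℕ) (f g : K) : K := f * msub (shiftSub m) g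

/-- `LIMU(f,g) = MU(f,g) - MU(g,f)` for `f ∈ Mould m`, `g ∈ Mould n`. -/
def LIMU (m n : ℕ) (f g : K) : K := MU m f g - MU n g f

/-- the pre-Lie product `f ↶ g` for `f ∈ Mould m`, `g ∈ Mould n`. -/
def preLieCurve (m n : ℕ) (f g : K) : K :=
  f * msub (shiftSub m) g * usum (m + 1) (m + n) / usum 1 (m + n)
    - g * msub (shiftSub n) f * usum 1 n / usum 1 (m + n)

/-- the pre-Lie product `f ∘ g = Σ_{i=1}^m f ∘_i g`, `f ∈ Mould m`, `g ∈ Mould n`. -/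
def preLieComp (m n : ℕ) (f g : K) : K := ∑ i ∈ Finset.Icc 1 m, comp n i f g

/-- `H_n = ∏_{1 ≤ i ≤ j ≤ n} u_{i..j}`. -/
def Hprod (n : ℕ) : K := ∏ i ∈ Finset.Icc 1 n, ∏ j ∈ Finset.Icc i n, usum i j

/-- `x` is (the image of) a polynomial in `u_1, …, u_n`. -/
def IsPolyIn (n : ℕ) (x : K) : Prop :=
  ∃ p : MPoly, (∀ k ∈ p.vars, 1 ≤ k ∧ k ≤ n) ∧ x = algebraMap MPoly K p

/-- `f ∈ Mould n` has nice poles: it is a polynomial divided by a product of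
powers of the linear forms `u_{i..j}`, `1 ≤ i ≤ j ≤ n`. -/
def HasNicePoles (n : ℕ) (f : K) : Prop :=
  ∃ (P : MPoly) (e : ℕ → ℕ → ℕ),
    (∀ k ∈ P.vars, 1 ≤ k ∧ k ≤ n) ∧
    f = algebraMap MPoly K P /
        ∏ i ∈ Finset.Icc 1 n, ∏ j ∈ Finset.Icc i n, usum i j ^ e i j

/-- the Over product `f / Y`, `f ∈ Mould n`. -/
def overY (n : ℕ) (f : K) : K := f / usum 1 (n + 1)

/-- the Under product `Y \ f`, `f ∈ Mould n`. -/
def underY (n : ℕ) (f : K) : K := msub (fun k => u (k + 1)) f / usum 1 (n + 1)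

/-- `ARIT(f,g) = f ∘ (g/Y) - f ∘ (Y\g)` for `f ∈ Mould m`, `g ∈ Mould n`. -/
def ARIT (m n : ℕ) (f g : K) : K :=
  preLieComp m (n + 1) f (overY n g) - preLieComp m (n + 1) f (underY n g)

/-- `ARI(f,g) = ARIT(f,g) - ARIT(g,f) + LIMU(f,g)`, `f ∈ Mould m`, `g ∈ Mould n`. -/
def ARI (m n : ℕ) (f g : K) : K := ARIT m n f g - ARIT n m g f + LIMU m n f g

/-- evaluation of polynomials into `RatFunc K` (rational functions in `t` over `K`). -/
def pevR (v : ℕ → RatFunc K) : MPoly →+* RatFunc K :=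
  eval₂Hom ((RatFunc.C).comp ((algebraMap MPoly K).comp (C : ℚ →+* MPoly))) v

/-- substitution into `RatFunc K`. -/
def msubR (v : ℕ → RatFunc K) (f : K) : RatFunc K :=
  if h : ∃ w : RatFunc K, ∃ p q : MPoly, q ≠ 0 ∧
      f = algebraMap MPoly K p / algebraMap MPoly K q ∧
      pevR v q ≠ 0 ∧ w = pevR v p / pevR v q
  then h.choose else 0

/-- residue at `t = 0`: the coefficient of `t⁻¹` in the Laurent expansion at `0`. -/
def res (r : RatFunc K) : K := (↑r : LaurentSeries K).coeff (-1)

/-- the mould derivative `∂f` for `f ∈ Mould m`: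
`∂f(u_1,…,u_{m-1}) = Σ_{j=1}^m Res_{t=0} f(u_1,…,u_{j-1},t,u_j,…,u_{m-1})`,
where `f(u_1,…,u_{j-1},t,u_j,…,u_{m-1})` is viewed in `RatFunc K`. -/
def mderiv (m : ℕ) (f : K) : K :=
  ∑ j ∈ Finset.Icc 1 m,
    res (msubR (fun k =>
      if k < j then RatFunc.C (u k)
      else if k = j then RatFunc.X
      else RatFunc.C (u (k - 1))) f)

/-- evaluation of polynomials into `ℚ(x)`, sending every variable to `1/x`. -/
def pevX : MPoly →+* RatFunc ℚ :=
  eval₂Hom (RatFunc.C : ℚ →+* RatFunc ℚ) (fun _ => (RatFunc.X)⁻¹)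

/-- the substitution `u_i ↦ 1/x`, landing in `ℚ(x)`. -/
def evalx (f : K) : RatFunc ℚ :=
  if h : ∃ w : RatFunc ℚ, ∃ p q : MPoly, q ≠ 0 ∧
      f = algebraMap MPoly K p / algebraMap MPoly K q ∧
      pevX q ≠ 0 ∧ w = pevX p / pevX q
  then h.choose else 0

/-- the derivative `d/dx` on `ℚ(x)`. -/
def rfDeriv (r : RatFunc ℚ) : RatFunc ℚ :=
  (algebraMap (Polynomial ℚ) (RatFunc ℚ) (Polynomial.derivative r.num) *
      algebraMap (Polynomial ℚ) (RatFunc ℚ) r.denom -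
    algebraMap (Polynomial ℚ) (RatFunc ℚ) r.num *
      algebraMap (Polynomial ℚ) (RatFunc ℚ) (Polynomial.derivative r.denom)) /
    algebraMap (Polynomial ℚ) (RatFunc ℚ) r.denom ^ 2

theorem msub_eq_of_hom {v : ℕ → K} {φ : K →+* K} (h : ∀ k, φ (u k) = v k) (f : K) :
    msub v f = φ f := by
  have hpev : pev v = φ.comp (algebraMap MPoly K) := by
    refine MvPolynomial.ringHom_ext' (Subsingleton.elim _ _) fun k => ?_
    simpa [pev, u] using (h k).symm
  have hex : ∃ w : K, ∃ p q : MPoly, q ≠ 0 ∧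
      f = algebraMap MPoly K p / algebraMap MPoly K q ∧
      pev v q ≠ 0 ∧ w = pev v p / pev v q := by
    obtain ⟨p, q, hq, rfl⟩ := IsFractionRing.div_surjective (A := MPoly) f
    have hq0 : q ≠ 0 := nonZeroDivisors.ne_zero hq
    refine ⟨_, p, q, hq0, rfl, ?_, rfl⟩
    simpa [hpev] using hq0
  rw [msub, dif_pos hex]
  obtain ⟨p, q, -, hf, -, hw⟩ := hex.choose_spec
  rw [hw, hf, hpev, map_div₀]
  rfl

theorem exists_hom_of_leftInverse (V W : ℕ → MPoly) (h : ∀ k, aeval W (V k) = X k) :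
    ∃ φ : K →+* K, ∀ k, φ (u k) = algebraMap MPoly K (V k) := by
  have hid : (aeval W).comp (aeval V) = AlgHom.id ℚ MPoly := by
    ext1 k
    simpa using h k
  have hinj : Function.Injective (aeval V : MPoly →ₐ[ℚ] MPoly) := by
    refine Function.LeftInverse.injective (g := aeval W) fun p => ?_
    rw [← AlgHom.comp_apply, hid, AlgHom.id_apply]
  have hinj' : Function.Injective
      ((algebraMap MPoly K).comp ((aeval V : MPoly →ₐ[ℚ] MPoly) : MPoly →+* MPoly)) := by
    rw [RingHom.coe_comp]
    exact (FaithfulSMul.algebraMap_injective MPoly K).comp hinj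
  refine ⟨IsFractionRing.lift hinj', fun k => ?_⟩
  rw [u, IsFractionRing.lift_algebraMap, RingHom.comp_apply, RingHom.coe_coe, aeval_X]

theorem exists_hom_compSubF (n i : ℕ) (hn : 1 ≤ n) :
    ∃ φ : K →+* K, ∀ k, φ (u k) = compSubF n i k := by
  obtain ⟨φ, hφ⟩ := exists_hom_of_leftInverse
    (fun k => if k < i then X k else if k = i then ∑ l ∈ Icc i (i + n - 1), X l
      else X (k + n - 1))
    (fun k => if k ≤ i then X k else if k < i + n then 0 else X (k + 1 - n)) (by
      intro k
      rcases lt_trichotomy k i with hk | rfl | hk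
      · simp [hk, hk.le]
      · simp only [lt_irrefl, if_false, if_true, map_sum, aeval_X]
        rw [Finset.sum_eq_single k]
        · simp
        · intro b hb hbk
          rw [Finset.mem_Icc] at hb
          rw [if_neg (by omega), if_pos (by omega)]
        · intro hk
          exact absurd (Finset.mem_Icc.2 ⟨le_rfl, by omega⟩) hk
      · simp only [if_neg hk.not_gt, if_neg hk.ne', aeval_X]
        rw [if_neg (by omega), if_neg (by omega)]
        congr 1
        omega)
  refine ⟨φ, fun k => ?_⟩
  rw [hφ, compSubF]
  split_ifs <;> simp [u, usum]

theorem exists_hom_compSubG (i : ℕ) (hi : 1 ≤ i) :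
    ∃ φ : K →+* K, ∀ k, φ (u k) = compSubG i k :=
  exists_hom_of_leftInverse (fun k => X (k + i - 1)) (fun k => X (k + 1 - i)) (by
    intro k
    rw [aeval_X]
    congr 1
    omega)

/-- The substitution defining `push n`. -/
def pushSub (n : ℕ) : ℕ → K := fun k =>
  if k = 1 then -(usum 1 n) else if k ≤ n then u (k - 1) else u k

theorem exists_hom_pushSub (n : ℕ) (hn : 1 ≤ n) :
    ∃ φ : K →+* K, ∀ k, φ (u k) = pushSub n k := by
  obtain ⟨N, rfl⟩ : ∃ N, n = N + 1 := ⟨n - 1, by omega⟩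
  obtain ⟨φ, hφ⟩ := exists_hom_of_leftInverse
    (fun k => if k = 1 then -∑ l ∈ Icc 1 (N + 1), X l
      else if k ≤ N + 1 then X (k - 1) else X k)
    (fun k => if k = 0 then X 0 else if k ≤ N then X (k + 1)
      else if k = N + 1 then -∑ l ∈ Icc 1 (N + 1), X l else X k) (by
      intro k
      by_cases h1 : k = 1
      · subst h1
        simp only [if_true, map_neg, map_sum, aeval_X]
        rw [Finset.sum_Icc_succ_top (by omega)]
        have hsum : ∀ l ∈ Icc 1 N, (if l = 0 then X 0 else if l ≤ N then X (l + 1)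
            else if l = N + 1 then -∑ l ∈ Icc 1 (N + 1), X l else X l : MPoly) =
            X (l + 1) := by
          intro l hl
          rw [Finset.mem_Icc] at hl
          rw [if_neg (by omega), if_pos hl.2]
        have hsplit : ∑ l ∈ Icc 1 (N + 1), (X l : MPoly) = X 1 + ∑ l ∈ Icc 1 N, X (l + 1) := by
          rw [← Finset.Ico_add_one_right_eq_Icc, ← Finset.Ico_add_one_right_eq_Icc,
            Finset.sum_eq_sum_Ico_succ_bot (by omega),
            Finset.sum_Ico_add' (fun l => (X l : MPoly)) 1 (N + 1) 1]
        rw [Finset.sum_congr rfl hsum, if_neg (by omega), if_neg (by omega), if_pos rfl, hsplit]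
        ring
      · by_cases h2 : k ≤ N + 1
        · rcases Nat.eq_zero_or_pos k with rfl | hk
          · simp
          · simp only [if_neg h1, if_pos h2, aeval_X]
            rw [if_neg (by omega), if_pos (by omega)]
            congr 1
            omega
        · simp only [if_neg h1, if_neg h2, aeval_X]
          rw [if_neg (by omega), if_neg (by omega), if_neg (by omega)])
  refine ⟨φ, fun k => ?_⟩
  rw [hφ, pushSub]
  split_ifs <;> simp [u, usum]

theorem hom_eq_of_mem_Mould {n : ℕ} {φ ψ : K →+* K}
    (h : ∀ k, 1 ≤ k → k ≤ n → φ (u k) = ψ (u k)) {f : K} (hf : f ∈ Mould n) : φ f = ψ f := by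
  have hle : Mould n ≤ φ.eqLocusField ψ := by
    refine Subfield.closure_le.2 ?_
    rintro _ ⟨k, hk1, hkn, rfl⟩
    exact h k hk1 hkn
  exact hle hf

theorem hom_usum_of_pushSub {N : ℕ} {φ : K →+* K} (h : ∀ k, φ (u k) = pushSub N k)
    {a b : ℕ} (ha : 1 ≤ a) (hb : b + 1 ≤ N) : φ (usum (a + 1) (b + 1)) = usum a b := by
  rw [usum, usum, map_sum, ← Finset.Ico_add_one_right_eq_Icc, ← Finset.Ico_add_one_right_eq_Icc,
    ← Finset.sum_Ico_add' (fun l => φ (u l)) a (b + 1) 1]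
  refine Finset.sum_congr rfl fun k hk => ?_
  rw [Finset.mem_Ico] at hk
  rw [h, pushSub, if_neg (by omega), if_pos (by omega), Nat.add_sub_cancel]

theorem sum_compSubF {n j m : ℕ} (hn : 1 ≤ n) (hj : 1 ≤ j) (hm : j ≤ m) :
    ∑ k ∈ Icc 1 m, compSubF n j k = usum 1 (m + n - 1) := by
  induction m, hm using Nat.le_induction with
  | base =>
    have hlow : ∑ k ∈ Ico 1 j, compSubF n j k = ∑ k ∈ Ico 1 j, u k :=
      Finset.sum_congr rfl fun k hk => if_pos (Finset.mem_Ico.1 hk).2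
    rw [← Finset.Ico_add_one_right_eq_Icc, Finset.sum_Ico_succ_top hj, hlow, compSubF,
      if_neg (lt_irrefl j), if_pos rfl, usum, usum, ← Finset.Ico_add_one_right_eq_Icc,
      ← Finset.Ico_add_one_right_eq_Icc, Finset.sum_Ico_consecutive _ hj (by omega)]
  | succ m hm ih =>
    rw [Finset.sum_Icc_succ_top (by omega), ih, compSubF, if_neg (by omega), if_neg (by omega),
      show m + 1 + n - 1 = (m + n - 1) + 1 by omega, usum, usum,
      Finset.sum_Icc_succ_top (by omega)]

/-- for `f ∈ Mould m`, `g ∈ Mould n` and `2 ≤ i ≤ m`, one has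
`τ(f ∘_i g) = τ(f) ∘_{i-1} g` in `Mould (m+n-1)`. -/
theorem push_comp (m n : ℕ) (hm : 1 ≤ m) (hn : 1 ≤ n)
    (f g : K) (hf : f ∈ Mould m) (hg : g ∈ Mould n)
    (i : ℕ) (hi : 2 ≤ i) (him : i ≤ m) :
    push (m + n - 1) (comp n i f g) = comp n (i - 1) (push m f) g := by
  obtain ⟨j, rfl⟩ : ∃ j, i = j + 1 := ⟨i - 1, by omega⟩
  obtain ⟨P, hP⟩ := exists_hom_pushSub (m + n - 1) (by omega)
  obtain ⟨Q, hQ⟩ := exists_hom_pushSub m hm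
  obtain ⟨F, hF⟩ := exists_hom_compSubF n (j + 1) hn
  obtain ⟨F', hF'⟩ := exists_hom_compSubF n j hn
  obtain ⟨G, hG⟩ := exists_hom_compSubG (j + 1) (by omega)
  obtain ⟨G', hG'⟩ := exists_hom_compSubG j (by omega)
  have husum : P (usum (j + 1) (j + 1 + n - 1)) = usum j (j + n - 1) := by
    rw [show j + 1 + n - 1 = (j + n - 1) + 1 by omega]
    exact hom_usum_of_pushSub hP (by omega) (by omega)
  have hPF : P (F f) = F' (Q f) := by
    refine hom_eq_of_mem_Mould (φ := P.comp F) (ψ := F'.comp Q) (fun k hk1 hkm => ?_) hf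
    rw [RingHom.comp_apply, RingHom.comp_apply, hF, hQ, pushSub]
    by_cases h1 : k = 1
    · subst h1
      rw [compSubF, if_pos (by omega), hP, pushSub, if_pos rfl, if_pos rfl, map_neg,
        usum, usum, map_sum]
      simp only [hF']
      rw [sum_compSubF hn (by omega) (by omega), usum]
    · rw [if_neg h1, if_pos hkm, hF', compSubF, compSubF]
      rcases lt_trichotomy k (j + 1) with hk | rfl | hk
      · rw [if_pos hk, if_pos (by omega), hP, pushSub, if_neg h1, if_pos (by omega)]
      · rw [if_neg (by omega), if_pos rfl, if_neg (by omega), if_pos (by omega), husum]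
      · rw [if_neg (by omega), if_neg (by omega), if_neg (by omega), if_neg (by omega), hP,
          pushSub, if_neg (by omega), if_pos (by omega)]
        congr 1
        omega
  have hPG : P (G g) = G' g := by
    refine hom_eq_of_mem_Mould (φ := P.comp G) (fun k hk1 hkn => ?_) hg
    rw [RingHom.comp_apply, hG, hG', compSubG, compSubG, hP, pushSub, if_neg (by omega),
      if_pos (by omega)]
    congr 1
  have hpush : ∀ N x, push N x = msub (pushSub N) x := fun _ _ => rfl
  rw [hpush, hpush, msub_eq_of_hom hP, msub_eq_of_hom hQ, Nat.add_sub_cancel, comp, comp,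
    msub_eq_of_hom hF, msub_eq_of_hom hG, msub_eq_of_hom hF', msub_eq_of_hom hG',
    map_mul, map_mul, husum, hPF, hPG]

end MouldOperad
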